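/- arXiv:2604.07880 — 5 statements merged into one kernel-verified Lean document; each statement's English description precedes it below -/
import Mathlib

section
/- Let s and δ be independent real random variables, let g : ℝ → ℝ be weakly decreasing, and let h : ℝ → ℝ be weakly decreasing with h(δ) integrable. Let c be a real number such that the event L = {s + g(δ) ≥ c} has positive probability. Then E[h(δ) | L] ≥ E[h(δ)]: conditioning on the upper tail of the contaminated signal s + g(δ) tilts the distribution of δ downward, increasing the conditional mean of any decreasing function of δ. -/
open MeasureTheory ProbabilityTheory

noncomputable section

/-- Conditional mean of `X` given an event `A`: `E[X | A] = E[X · 1_A] / P(A)`. -/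
def condMean {Ω : Type*} [MeasurableSpace Ω] (μ : Measure Ω) (A : Set Ω) (X : Ω → ℝ) : ℝ :=
  (∫ ω in A, X ω ∂μ) / (μ A).toReal

lemma lowerSet_aux (ν : Measure ℝ) (φ : ℝ → ℝ) (hφ : Antitone φ) (hi : Integrable φ ν)
    (h0 : ∫ x, φ x ∂ν = 0) (K : Set ℝ) (hK : MeasurableSet K)
    (hl : ∀ x y, x ≤ y → y ∈ K → x ∈ K) : 0 ≤ ∫ x in K, φ x ∂ν := by
  by_cases hc : ∀ x ∈ K, 0 ≤ φ x
  · exact setIntegral_nonneg hK hc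
  · push Not at hc
    obtain ⟨d, hd, hd'⟩ := hc
    have h1 := integral_add_compl hK hi
    have h2 : ∫ x in Kᶜ, φ x ∂ν ≤ 0 := by
      refine setIntegral_nonpos hK.compl fun x hx => ?_
      have : d ≤ x := by
        by_contra hlt
        exact hx (hl x d (le_of_lt (not_le.1 hlt)) hd)
      exact (hφ this).trans hd'.le
    linarith

/-- Conditioning on the upper tail of the contaminated signal `s + g(δ)` (with `g` weakly
decreasing) tilts `δ` downward, increasing the conditional mean of any weakly decreasing
function `h` of `δ`. -/
theorem upper_tail_increases_decreasing_mean
    {Ω : Type*} [MeasurableSpace Ω] (μ : Measure Ω) [IsProbabilityMeasure μ]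
    (s δ : Ω → ℝ) (hs : Measurable s) (hδ : Measurable δ)
    (hindep : IndepFun s δ μ)
    (g h : ℝ → ℝ) (hg : Antitone g) (hh : Antitone h)
    (hint : Integrable (fun ω => h (δ ω)) μ)
    (c : ℝ) (hL : 0 < μ {ω | c ≤ s ω + g (δ ω)}) :
    ∫ ω, h (δ ω) ∂μ ≤ condMean μ {ω | c ≤ s ω + g (δ ω)} (fun ω => h (δ ω)) := by
  have hgm : Measurable g := hg.measurable
  have hhm : Measurable h := hh.measurable
  set m := ∫ ω, h (δ ω) ∂μ with hm
  set L := {ω | c ≤ s ω + g (δ ω)} with hLdef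
  have hLm : MeasurableSet L := measurableSet_le measurable_const (hs.add (hgm.comp hδ))
  have hpos : 0 < (μ L).toReal := ENNReal.toReal_pos hL.ne' (measure_ne_top _ _)
  have : IsProbabilityMeasure (μ.map s) := Measure.isProbabilityMeasure_map hs.aemeasurable
  have : IsProbabilityMeasure (μ.map δ) := Measure.isProbabilityMeasure_map hδ.aemeasurable
  have hprod := (indepFun_iff_map_prod_eq_prod_map_map hs.aemeasurable hδ.aemeasurable).1 hindep
  have hφm : Measurable (fun x => h x - m) := hhm.sub_const m
  have hφi : Integrable (fun x => h x - m) (μ.map δ) := by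
    rw [integrable_map_measure hφm.aestronglyMeasurable hδ.aemeasurable]
    exact hint.sub (integrable_const m)
  have hφ0 : ∫ x, (h x - m) ∂(μ.map δ) = 0 := by
    rw [integral_map hδ.aemeasurable hφm.aestronglyMeasurable,
      integral_sub hint (integrable_const m)]
    simp [← hm]
  let T : Set (ℝ × ℝ) := {p | c ≤ p.1 + g p.2}
  have hT : MeasurableSet T :=
    measurableSet_le measurable_const (measurable_fst.add (hgm.comp measurable_snd))
  have key : 0 ≤ ∫ ω in L, (h (δ ω) - m) ∂μ := by
    have e1 : ∫ ω in L, (h (δ ω) - m) ∂μ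
        = ∫ p, T.indicator (fun p => h p.2 - m) p ∂(μ.map (fun ω => (s ω, δ ω))) := by
      have hTm : Measurable (T.indicator (fun p : ℝ × ℝ => h p.2 - m)) :=
        (hφm.comp measurable_snd).indicator hT
      rw [integral_map (hs.prodMk hδ).aemeasurable hTm.aestronglyMeasurable,
        ← integral_indicator hLm]
      rfl
    rw [e1, hprod, integral_prod _ ((hφi.comp_snd (μ.map s)).indicator hT)]
    refine integral_nonneg fun x => ?_
    have hK : MeasurableSet {y | c ≤ x + g y} :=
      measurableSet_le measurable_const (measurable_const.add hgm)
    have := lowerSet_aux (μ.map δ) (fun x => h x - m)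
      (fun a b hab => sub_le_sub_right (hh hab) m) hφi hφ0 {y | c ≤ x + g y} hK
      (fun a b hab hb => by
        have h1 := hg hab
        simp only [Set.mem_setOf_eq] at hb ⊢
        linarith)
    rw [← integral_indicator hK] at this
    exact this
  rw [integral_sub hint.integrableOn (integrable_const m)] at key
  rw [condMean, le_div_iff₀ hpos]
  simp [Measure.real] at key
  linarith

end
end

section
/- Let s and δ be independent real random variables, let g : ℝ → ℝ be weakly decreasing, and let h : ℝ → ℝ be weakly decreasing with h(δ) integrable. Let c be a real number such that the event S = {s + g(δ) ≤ c} has positive probability. Then E[h(δ) | S] ≤ E[h(δ)]: conditioning on the lower tail of the contaminated signal s + g(δ) tilts the distribution of δ upward, decreasing the conditional mean of any decreasing function of δ. -/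
open MeasureTheory ProbabilityTheory

noncomputable section

theorem upper_aux (ν : Measure ℝ) [IsProbabilityMeasure ν] (h : ℝ → ℝ) (hh : Antitone h)
    (hint : Integrable h ν) (A : Set ℝ) (hA : MeasurableSet A) (hup : IsUpperSet A) :
    ∫ x in A, (h x - ∫ y, h y ∂ν) ∂ν ≤ 0 := by
  set m := ∫ y, h y ∂ν with hm
  have hi : Integrable (fun x => h x - m) ν := hint.sub (integrable_const m)
  by_cases hc : ∃ x ∈ A, m ≤ h x
  · obtain ⟨x, hx, hmx⟩ := hc
    have h1 := integral_add_compl hA hi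
    have h2 : ∫ x, (h x - m) ∂ν = 0 := by
      rw [integral_sub hint (integrable_const m)]
      simp [hm]
    have h3 : 0 ≤ ∫ x in Aᶜ, (h x - m) ∂ν := by
      refine setIntegral_nonneg hA.compl fun y hy => ?_
      have hyx : y ≤ x := by
        by_contra hlt
        exact hy (hup (not_le.mp hlt).le hx)
      have := hh hyx
      linarith
    linarith
  · push Not at hc
    exact setIntegral_nonpos hA fun x hx => by linarith [hc x hx]

/-- Conditioning on the lower tail of the contaminated signal `s + g(δ)` (with `g` weakly
decreasing) tilts `δ` upward, decreasing the conditional mean of any weakly decreasing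
function `h` of `δ`. -/
theorem lower_tail_decreases_decreasing_mean
    {Ω : Type*} [MeasurableSpace Ω] (μ : Measure Ω) [IsProbabilityMeasure μ]
    (s δ : Ω → ℝ) (hs : Measurable s) (hδ : Measurable δ)
    (hindep : IndepFun s δ μ)
    (g h : ℝ → ℝ) (hg : Antitone g) (hh : Antitone h)
    (hint : Integrable (fun ω => h (δ ω)) μ)
    (c : ℝ) (hS : 0 < μ {ω | s ω + g (δ ω) ≤ c}) :
    condMean μ {ω | s ω + g (δ ω) ≤ c} (fun ω => h (δ ω)) ≤ ∫ ω, h (δ ω) ∂μ := by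
  have hhm : Measurable h := hh.measurable
  have hgm : Measurable g := hg.measurable
  have hT : MeasurableSet {p : ℝ × ℝ | p.1 + g p.2 ≤ c} :=
    measurableSet_le (measurable_fst.add (hgm.comp measurable_snd)) measurable_const
  have hSm : MeasurableSet {ω | s ω + g (δ ω) ≤ c} := (hs.prodMk hδ) hT
  have : IsProbabilityMeasure (μ.map s) := Measure.isProbabilityMeasure_map hs.aemeasurable
  have : IsProbabilityMeasure (μ.map δ) := Measure.isProbabilityMeasure_map hδ.aemeasurable
  have hj := (indepFun_iff_map_prod_eq_prod_map_map hs.aemeasurable hδ.aemeasurable).1 hindep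
  have hintν : Integrable h (μ.map δ) :=
    (integrable_map_measure hhm.aestronglyMeasurable hδ.aemeasurable).2 hint
  have hmν : ∫ y, h y ∂(μ.map δ) = ∫ ω, h (δ ω) ∂μ :=
    integral_map hδ.aemeasurable hhm.aestronglyMeasurable
  set m := ∫ ω, h (δ ω) ∂μ with hm
  have key : ∫ ω in {ω | s ω + g (δ ω) ≤ c}, (h (δ ω) - m) ∂μ ≤ 0 := by
    have e1 : ∫ ω in {ω | s ω + g (δ ω) ≤ c}, (h (δ ω) - m) ∂μ
        = ∫ p in {p : ℝ × ℝ | p.1 + g p.2 ≤ c}, (h p.2 - m) ∂((μ.map s).prod (μ.map δ)) := by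
      have hM : Measurable (fun p : ℝ × ℝ => h p.2 - m) :=
        (hhm.comp measurable_snd).sub measurable_const
      rw [← hj, setIntegral_map hT hM.aestronglyMeasurable
        (hs.prodMk hδ).aemeasurable]
      rfl
    have hip : Integrable (fun p : ℝ × ℝ => h p.2 - m) ((μ.map s).prod (μ.map δ)) :=
      (hintν.comp_snd (μ.map s)).sub (integrable_const m)
    rw [e1, ← integral_indicator hT, integral_prod _ (hip.indicator hT)]
    refine integral_nonpos fun x => ?_
    have hA : MeasurableSet {y : ℝ | x + g y ≤ c} :=
      measurableSet_le (measurable_const.add hgm) measurable_const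
    have hu := upper_aux (μ.map δ) h hh hintν {y : ℝ | x + g y ≤ c} hA (by
      intro a b hab ha
      have := hg hab
      simp only [Set.mem_ofPred_eq] at ha ⊢
      linarith)
    rw [hmν, ← integral_indicator hA] at hu
    exact hu
  have hpos : 0 < (μ {ω | s ω + g (δ ω) ≤ c}).toReal :=
    ENNReal.toReal_pos hS.ne' (measure_ne_top _ _)
  rw [integral_sub hint.integrableOn (integrable_const m)] at key
  simp only [integral_const, smul_eq_mul, measureReal_restrict_apply_univ] at key
  unfold condMean
  rw [div_le_iff₀ hpos]
  simp only [Measure.real] at key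
  linarith

end
end

section
/- (Gaussian projection.) Let X and Y be independent real Gaussian random variables with mean zero and variances σ_X² and σ_Y², with σ_X² + σ_Y² > 0. Then the conditional expectation of Y given X + Y satisfies E[Y | X + Y] = (σ_Y² / (σ_X² + σ_Y²)) · (X + Y) almost surely. -/
open MeasureTheory ProbabilityTheory
open scoped NNReal

noncomputable section

/-- Gaussian projection: for independent centered Gaussians `X`, `Y` with variances
`σ_X²`, `σ_Y²` (not both zero), `E[Y | X + Y] = (σ_Y² / (σ_X² + σ_Y²)) · (X + Y)` a.s. -/
theorem gaussian_projection
    {Ω : Type*} [MeasurableSpace Ω] (μ : Measure Ω) [IsProbabilityMeasure μ]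
    (X Y : Ω → ℝ) (hX : Measurable X) (hY : Measurable Y)
    (hindep : IndepFun X Y μ)
    (vX vY : ℝ≥0) (hv : 0 < vX + vY)
    (hXlaw : μ.map X = gaussianReal 0 vX)
    (hYlaw : μ.map Y = gaussianReal 0 vY) :
    μ[Y | MeasurableSpace.comap (fun ω => X ω + Y ω) (inferInstance : MeasurableSpace ℝ)]
      =ᵐ[μ] fun ω => ((vY : ℝ) / ((vX : ℝ) + (vY : ℝ))) * (X ω + Y ω) := by
  have gX : HasGaussianLaw X μ := ⟨by rw [hXlaw]; infer_instance⟩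
  have gY : HasGaussianLaw Y μ := ⟨by rw [hYlaw]; infer_instance⟩
  have hv' : (0 : ℝ) < vX + vY := by exact_mod_cast hv
  have g := hindep.hasGaussianLaw gX gY
  have eX : ∫ ω, X ω ∂μ = 0 := by
    have := integral_map (μ := μ) hX.aemeasurable (f := fun x : ℝ => x) (by fun_prop)
    rw [← this, hXlaw, integral_id_gaussianReal]
  have eY : ∫ ω, Y ω ∂μ = 0 := by
    have := integral_map (μ := μ) hY.aemeasurable (f := fun x : ℝ => x) (by fun_prop)
    rw [← this, hYlaw, integral_id_gaussianReal]
  have wX : Var[X; μ] = vX := by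
    have := variance_map (μ := μ) (X := id) (Y := X) (by fun_prop) hX.aemeasurable
    rw [hXlaw, variance_id_gaussianReal] at this
    exact this.symm
  have wY : Var[Y; μ] = vY := by
    have := variance_map (μ := μ) (X := id) (Y := Y) (by fun_prop) hY.aemeasurable
    rw [hYlaw, variance_id_gaussianReal] at this
    exact this.symm
  have mX := gX.memLp_two
  have mY := gY.memLp_two
  set c : ℝ := (vY : ℝ) / ((vX : ℝ) + (vY : ℝ)) with hc
  have hcc : (1 - c) * vY = c * vX := by rw [hc]; field_simp; ring
  have g2 : HasGaussianLaw (fun ω => ((1 - c) * Y ω - c * X ω, X ω + Y ω)) μ :=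
    g.map_fun (((1 - c) • ContinuousLinearMap.snd ℝ ℝ ℝ - c • ContinuousLinearMap.fst ℝ ℝ ℝ).prod
      (ContinuousLinearMap.fst ℝ ℝ ℝ + ContinuousLinearMap.snd ℝ ℝ ℝ))
  have cXY : cov[X, Y; μ] = 0 := hindep.covariance_eq_zero mX mY
  have hcov : cov[fun ω => (1 - c) * Y ω - c * X ω, fun ω => X ω + Y ω; μ] = 0 := by
    change cov[(fun ω => (1 - c) * Y ω) - (fun ω => c * X ω), X + Y; μ] = 0
    rw [covariance_sub_left (mY.const_mul _) (mX.const_mul _) (mX.add mY),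
      covariance_const_mul_left, covariance_const_mul_left,
      covariance_add_right mY mX mY, covariance_add_right mX mX mY,
      covariance_comm Y X, cXY, covariance_self hX.aemeasurable, covariance_self hY.aemeasurable,
      wX, wY]
    linarith
  have hind := g2.indepFun_of_covariance_eq_zero hcov
  have mS : Measurable (fun ω => X ω + Y ω) := by fun_prop
  have mZ : Measurable (fun ω => (1 - c) * Y ω - c * X ω) := by fun_prop
  set m := MeasurableSpace.comap (fun ω => X ω + Y ω) (inferInstance : MeasurableSpace ℝ) with hm
  have hle : m ≤ _ := mS.comap_le
  have iX := gX.integrable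
  have iY := gY.integrable
  have h1 := condExp_indep_eq (μ := μ) mZ.comap_le hle
    (comap_measurable (fun ω => (1 - c) * Y ω - c * X ω)).stronglyMeasurable hind
  have eZ : ∫ ω, ((1 - c) * Y ω - c * X ω) ∂μ = 0 := by
    rw [integral_sub (iY.const_mul _) (iX.const_mul _), integral_const_mul, integral_const_mul,
      eX, eY]; simp
  rw [eZ] at h1
  have iS : Integrable (fun ω => c * (X ω + Y ω)) μ := (iX.add iY).const_mul c
  have h2 : μ[fun ω => c * (X ω + Y ω) | m] = fun ω => c * (X ω + Y ω) :=
    condExp_of_stronglyMeasurable hle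
      ((comap_measurable (fun ω => X ω + Y ω)).const_mul c).stronglyMeasurable iS
  have h3 := condExp_add ((iY.const_mul (1 - c)).sub (iX.const_mul c)) iS m
  have h4 : Y = (fun ω => (1 - c) * Y ω) - (fun ω => c * X ω) + fun ω => c * (X ω + Y ω) := by
    ext ω; simp only [Pi.add_apply, Pi.sub_apply]; ring
  have h5 : μ[Y | m] = μ[(fun ω => (1 - c) * Y ω) - (fun ω => c * X ω) +
      fun ω => c * (X ω + Y ω) | m] := congrArg (fun f => μ[f | m]) h4
  rw [h5]
  filter_upwards [h1, h3] with ω k1 k3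
  rw [k3, Pi.add_apply, h2]
  have k1' : (μ[(fun ω => (1 - c) * Y ω) - (fun ω => c * X ω) | m]) ω = 0 := k1
  rw [k1', zero_add]

end
end

section
/- (Pure-noise limit.) Let δ, δ′ be independent centered real Gaussian random variables with variance σ_δ² > 0, let a < 0 be a constant, and set ŝ = a·δ (observed signal with no true-signal variation, σ_s = 0, noise share ρ = 1) and ε = δ′ − δ. Let α ∈ (0,1) and let c_L, c_S be the real numbers with P(ŝ ≥ c_L) = α and P(ŝ ≤ c_S) = α. Then E[ε | ŝ ≥ c_L] − E[ε | ŝ ≤ c_S] = 2·κ(α)·σ_δ: sorting on pure noise produces a long–short bias of 2κσ_δ even though the true long–short return is zero. -/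
open MeasureTheory ProbabilityTheory Real

noncomputable section

/-- The standard normal density `φ(z) = (1/√(2π))·exp(−z²/2)`. -/
def stdNormalPDF (z : ℝ) : ℝ := (Real.sqrt (2 * Real.pi))⁻¹ * Real.exp (-z ^ 2 / 2)

lemma aux_int_gauss (t : ℝ) :
    ∫ x in Set.Iic t, x ∂(gaussianReal 0 1) = - stdNormalPDF t := by
  rw [← integral_indicator measurableSet_Iic,
    integral_gaussianReal_eq_integral_smul (one_ne_zero)]
  have h1 : (fun x => gaussianPDFReal 0 1 x • (Set.Iic t).indicator (fun x => x) x)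
      = (Set.Iic t).indicator (fun x => stdNormalPDF x * x) := by
    ext x
    by_cases hx : x ∈ Set.Iic t
    · simp [hx, gaussianPDFReal, stdNormalPDF]
    · simp [hx]
  rw [h1, integral_indicator measurableSet_Iic]
  have hd : ∀ x ∈ Set.Iic t, HasDerivAt (fun y => - stdNormalPDF y) (stdNormalPDF x * x) x := by
    intro x _
    unfold stdNormalPDF
    have h2 : HasDerivAt (fun y : ℝ => -y ^ 2 / 2) (-x) x := by
      have := ((hasDerivAt_pow 2 x).neg).div_const 2
      refine this.congr_deriv ?_
      norm_num
      ring
    convert! ((h2.exp).const_mul (√(2 * π))⁻¹).neg using 1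
    ring
  have hint : Integrable (fun x => stdNormalPDF x * x) := by
    have := (integrable_mul_exp_neg_mul_sq (b := 1/2) (by norm_num)).const_mul (√(2 * π))⁻¹
    refine this.congr (Filter.Eventually.of_forall fun x => ?_)
    simp only [stdNormalPDF]
    rw [show -x ^ 2 / 2 = -(1/2) * x ^ 2 by ring]
    ring
  have hlim : Filter.Tendsto (fun y => - stdNormalPDF y) Filter.atBot (nhds 0) := by
    have h3 : Filter.Tendsto (fun y : ℝ => -y ^ 2 / 2) Filter.atBot Filter.atBot := by
      have h4 : Filter.Tendsto (fun y : ℝ => y ^ 2) Filter.atBot Filter.atTop := by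
        simpa only [sq, id] using (Filter.tendsto_id (α := ℝ)).atBot_mul_atBot₀ Filter.tendsto_id
      exact (Filter.tendsto_neg_atTop_atBot.comp h4).atBot_div_const (by norm_num)
    have h5 := ((Real.tendsto_exp_atBot.comp h3).const_mul (√(2 * π))⁻¹).neg
    simpa [stdNormalPDF, Function.comp_def] using h5
  rw [integral_Iic_of_hasDerivAt_of_tendsto' hd hint.integrableOn hlim]
  simp

lemma aux_le_of (s t : ℝ)
    (h : (gaussianReal 0 1).real (Set.Iic s) = (gaussianReal 0 1).real (Set.Iic t)) :
    t ≤ s := by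
  by_contra! hlt
  have h1 : (gaussianReal 0 1).real (Set.Iic t \ Set.Iic s) = 0 := by
    rw [measureReal_sdiff (Set.Iic_subset_Iic.2 hlt.le) measurableSet_Iic, h, sub_self]
  rw [measureReal_eq_zero_iff] at h1
  have h2 := gaussianReal_absolutelyContinuous' 0 (one_ne_zero) h1
  rw [show Set.Iic t \ Set.Iic s = Set.Ioc s t by ext x; simp [and_comm], Real.volume_Ioc, ENNReal.ofReal_eq_zero] at h2
  linarith

lemma aux_half {Ω : Type*} [MeasurableSpace Ω] (μ : Measure Ω) [IsProbabilityMeasure μ]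
    (Z W : Ω → ℝ) (hZ : Measurable Z) (hW : Measurable W) (hi : IndepFun Z W μ)
    (hZl : μ.map Z = gaussianReal 0 1) (hWi : Integrable W μ) (hW0 : ∫ ω, W ω ∂μ = 0)
    (σ α q t : ℝ) (hq : cdf (gaussianReal 0 1) q = α)
    (ht : (μ {ω | Z ω ≤ t}).toReal = α) :
    ∫ ω in {ω | Z ω ≤ t}, (W ω + σ * Z ω) ∂μ = - σ * stdNormalPDF q := by
  have hA : MeasurableSet {ω | Z ω ≤ t} := measurableSet_le hZ measurable_const
  have hm : (gaussianReal 0 1).real (Set.Iic t) = α := by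
    rw [← hZl, map_measureReal_apply hZ measurableSet_Iic]
    exact ht
  rw [cdf_eq_real] at hq
  have htq : t = q := le_antisymm (aux_le_of q t (hq.trans hm.symm)) (aux_le_of t q (hm.trans hq.symm))
  have hZi : Integrable Z μ := by
    have : Integrable id (μ.map Z) := by
      rw [hZl]; exact memLp_one_iff_integrable.1 (memLp_id_gaussianReal 1)
    exact this.comp_measurable hZ
  have h1 : ∫ ω in {ω | Z ω ≤ t}, W ω ∂μ = 0 := by
    have hi2 : IndepFun (fun ω => (Set.Iic t).indicator (fun _ => (1:ℝ)) (Z ω)) W μ :=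
      hi.comp (φ := (Set.Iic t).indicator (fun _ => (1:ℝ))) (ψ := id)
        (measurable_const.indicator measurableSet_Iic) measurable_id
    have h2 := hi2.integral_fun_mul_eq_mul_integral
      ((measurable_const.indicator measurableSet_Iic).comp hZ).aestronglyMeasurable
      hW.aestronglyMeasurable
    rw [hW0, mul_zero] at h2
    rw [← integral_indicator hA, ← h2]
    congr 1
    ext ω
    by_cases h : Z ω ≤ t <;> simp [Set.indicator, h]
  have h2 : ∫ ω in {ω | Z ω ≤ t}, Z ω ∂μ = - stdNormalPDF q := by
    rw [← htq, ← aux_int_gauss, ← hZl,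
      setIntegral_map measurableSet_Iic (f := fun x => x) measurable_id.aestronglyMeasurable hZ.aemeasurable]
    rfl
  rw [integral_add hWi.integrableOn (hZi.const_mul σ).integrableOn, integral_const_mul, h1, h2]
  ring

/-- Pure-noise limit: sorting on pure noise `ŝ = a·δ` (`a < 0`, no true-signal variation,
noise share `ρ = 1`) produces a long–short bias of `2·κ(α)·σ_δ`, where `κ(α) = φ(Φ⁻¹(α))/α`
(encoded via `Φ(q) = α`), even though the true long–short return is zero. -/
theorem pure_noise_limit_bias
    {Ω : Type*} [MeasurableSpace Ω] (μ : Measure Ω) [IsProbabilityMeasure μ]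
    (δ δ' : Ω → ℝ) (hδ : Measurable δ) (hδ' : Measurable δ')
    (hindep : IndepFun δ δ' μ)
    (σδ : ℝ) (hσδ : 0 < σδ)
    (hδlaw : μ.map δ = gaussianReal 0 ((σδ ^ 2).toNNReal))
    (hδ'law : μ.map δ' = gaussianReal 0 ((σδ ^ 2).toNNReal))
    (a : ℝ) (ha : a < 0)
    (shat ε : Ω → ℝ)
    (hshat : ∀ ω, shat ω = a * δ ω)
    (hεdef : ∀ ω, ε ω = δ' ω - δ ω)
    (α : ℝ) (hα : α ∈ Set.Ioo (0 : ℝ) 1)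
    (q : ℝ) (hq : cdf (gaussianReal 0 1) q = α)
    (cL cS : ℝ)
    (hcL : (μ {ω | cL ≤ shat ω}).toReal = α)
    (hcS : (μ {ω | shat ω ≤ cS}).toReal = α) :
    condMean μ {ω | cL ≤ shat ω} ε - condMean μ {ω | shat ω ≤ cS} ε
      = 2 * (stdNormalPDF q / α) * σδ := by
  have hv : (σδ ^ 2).toNNReal ≠ 0 := by
    simp only [ne_eq, Real.toNNReal_eq_zero, not_le]; positivity
  have hlaw : ∀ c : ℝ, c ^ 2 * σδ ^ 2 = 1 → μ.map (fun ω => c * δ ω) = gaussianReal 0 1 := by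
    intro c hc
    have h1 : μ.map (fun ω => c * δ ω) = (μ.map δ).map (fun x => c * x) := by
      rw [Measure.map_map (measurable_const_mul c) hδ]; rfl
    rw [h1, hδlaw, gaussianReal_map_const_mul, mul_zero]
    congr 1
    ext
    simp [hc, Real.coe_toNNReal _ (sq_nonneg σδ)]
  have hWi : Integrable δ' μ := by
    have : Integrable id (μ.map δ') := by
      rw [hδ'law]; exact memLp_one_iff_integrable.1 (memLp_id_gaussianReal 1)
    exact this.comp_measurable hδ'
  have hW0 : ∫ ω, δ' ω ∂μ = 0 := by
    have : ∫ x, x ∂(μ.map δ') = 0 := by rw [hδ'law, integral_id_gaussianReal]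
    rwa [integral_map (f := fun x => x) hδ'.aemeasurable measurable_id.aestronglyMeasurable] at this
  have hind : ∀ c : ℝ, IndepFun (fun ω => c * δ ω) δ' μ := fun c =>
    hindep.comp (φ := fun x => c * x) (ψ := id) (measurable_const_mul c) measurable_id
  have eL : {ω | cL ≤ shat ω} = {ω | σδ⁻¹ * δ ω ≤ σδ⁻¹ * (cL / a)} := by
    ext ω
    simp only [Set.mem_ofPred_eq, hshat]
    rw [mul_le_mul_iff_right₀ (inv_pos.2 hσδ), le_div_iff_of_neg ha, mul_comm]
  have eS : {ω | shat ω ≤ cS} = {ω | -σδ⁻¹ * δ ω ≤ -σδ⁻¹ * (cS / a)} := by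
    ext ω
    simp only [Set.mem_ofPred_eq, hshat]
    rw [neg_mul, neg_mul, neg_le_neg_iff, mul_le_mul_iff_right₀ (inv_pos.2 hσδ),
      div_le_iff_of_neg ha, mul_comm]
  have hL := aux_half μ (fun ω => σδ⁻¹ * δ ω) δ' (hδ.const_mul _) hδ' (hind _)
    (hlaw _ (by field_simp)) hWi hW0 (-σδ) α q _ hq (by rw [← hcL, eL])
  have hS := aux_half μ (fun ω => -σδ⁻¹ * δ ω) δ' (hδ.const_mul _) hδ' (hind _)
    (hlaw _ (by field_simp)) hWi hW0 σδ α q _ hq (by rw [← hcS, eS])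
  have f1 : (fun ω => δ' ω + -σδ * (σδ⁻¹ * δ ω)) = ε := by
    ext ω; rw [hεdef]; field_simp; ring
  have f2 : (fun ω => δ' ω + σδ * (-σδ⁻¹ * δ ω)) = ε := by
    ext ω; rw [hεdef]; field_simp; ring
  simp only [← eL, ← eS] at hL hS
  rw [f1] at hL
  rw [f2] at hS
  unfold condMean
  rw [hL, hS, hcL, hcS]
  ring

end
end

section
/- (Positivity of the classic price-noise return bias.) Let δ_t and δ_{t+1} be independent real random variables, each with mean zero, taking values in (−1, ∞), and such that 1/(1+δ_t) is integrable. Then the exact return measurement error ε = (1+δ_{t+1})/(1+δ_t) − 1 has nonnegative expectation: E[ε] = E[1/(1+δ_t)] − 1 ≥ 0, with strict inequality whenever δ_t is not almost surely equal to 0. Thus mean-zero multiplicative price noise in the return denominator inflates expected measured returns even when the true return is zero. -/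
open MeasureTheory ProbabilityTheory

noncomputable section

/-- Positivity of the classic price-noise return bias: with `δ_t, δ_{t+1}` independent,
mean zero, valued in `(−1, ∞)`, and `1/(1+δ_t)` integrable, the exact return measurement
error `ε = (1+δ_{t+1})/(1+δ_t) − 1` satisfies `E[ε] = E[1/(1+δ_t)] − 1 ≥ 0`, with strict
inequality whenever `δ_t` is not almost surely `0`. -/
theorem price_noise_return_bias_nonneg
    {Ω : Type*} [MeasurableSpace Ω] (μ : Measure Ω) [IsProbabilityMeasure μ]
    (δt δt1 : Ω → ℝ) (hindep : IndepFun δt δt1 μ)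
    (hδt_int : Integrable δt μ) (hδt1_int : Integrable δt1 μ)
    (hmean_t : ∫ ω, δt ω ∂μ = 0) (hmean_t1 : ∫ ω, δt1 ω ∂μ = 0)
    (hδt_range : ∀ ω, -1 < δt ω) (hδt1_range : ∀ ω, -1 < δt1 ω)
    (hinv : Integrable (fun ω => (1 + δt ω)⁻¹) μ)
    (ε : Ω → ℝ) (hεdef : ∀ ω, ε ω = (1 + δt1 ω) / (1 + δt ω) - 1) :
    (∫ ω, ε ω ∂μ) = (∫ ω, (1 + δt ω)⁻¹ ∂μ) - 1 ∧
    0 ≤ ∫ ω, ε ω ∂μ ∧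
    (¬ (δt =ᵐ[μ] fun _ => 0) → 0 < ∫ ω, ε ω ∂μ) := by
  have h1 : (fun ω => ε ω) = fun ω => (1 + δt ω)⁻¹ * (1 + δt1 ω) - 1 := by
    funext ω
    rw [hεdef ω, div_eq_mul_inv, mul_comm]
  have hi1 : Integrable (fun ω => 1 + δt1 ω) μ := (integrable_const 1).add hδt1_int
  have hind : IndepFun (fun ω => (1 + δt ω)⁻¹) (fun ω => 1 + δt1 ω) μ :=
    hindep.comp (φ := fun x : ℝ => (1 + x)⁻¹) (ψ := fun x : ℝ => 1 + x)
      (by fun_prop) (by fun_prop)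
  have hprod : Integrable (fun ω => (1 + δt ω)⁻¹ * (1 + δt1 ω)) μ :=
    hind.integrable_mul hinv hi1
  have hm1 : ∫ ω, (1 + δt1 ω) ∂μ = 1 := by
    rw [integral_add (integrable_const 1) hδt1_int, hmean_t1]
    simp
  have hmul : ∫ ω, (1 + δt ω)⁻¹ * (1 + δt1 ω) ∂μ = ∫ ω, (1 + δt ω)⁻¹ ∂μ := by
    rw [hind.integral_fun_mul_eq_mul_integral hinv.aestronglyMeasurable
      hi1.aestronglyMeasurable, hm1, mul_one]
  have hE : (∫ ω, ε ω ∂μ) = (∫ ω, (1 + δt ω)⁻¹ ∂μ) - 1 := by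
    rw [h1, integral_sub hprod (integrable_const 1), hmul]
    simp
  have hgi : Integrable (fun ω => (1 + δt ω)⁻¹ - 1 + δt ω) μ :=
    (hinv.sub (integrable_const 1)).add hδt_int
  have hg : ∫ ω, ((1 + δt ω)⁻¹ - 1 + δt ω) ∂μ = ∫ ω, ε ω ∂μ := by
    have hs : Integrable (fun ω => (1 + δt ω)⁻¹ - 1) μ := hinv.sub (integrable_const 1)
    rw [integral_add hs hδt_int,
      integral_sub hinv (integrable_const 1), hmean_t, hE]
    simp
  have hform : ∀ ω, (1 + δt ω)⁻¹ - 1 + δt ω = δt ω ^ 2 / (1 + δt ω) := by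
    intro ω
    have h : 1 + δt ω ≠ 0 := by linarith [hδt_range ω]
    field_simp
    ring
  have hpos : ∀ ω, 0 ≤ (1 + δt ω)⁻¹ - 1 + δt ω := by
    intro ω
    rw [hform]
    exact div_nonneg (sq_nonneg _) (by linarith [hδt_range ω])
  have hnn : 0 ≤ ∫ ω, ε ω ∂μ := hg ▸ integral_nonneg hpos
  refine ⟨hE, hnn, fun hne => lt_of_le_of_ne hnn fun h0 => hne ?_⟩
  rw [← hg] at h0
  have hz := (integral_eq_zero_iff_of_nonneg hpos hgi).1 h0.symm
  filter_upwards [hz] with ω hω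
  have h : 1 + δt ω ≠ 0 := by linarith [hδt_range ω]
  have hω' : δt ω ^ 2 / (1 + δt ω) = 0 := by
    rw [← hform]
    exact hω
  simpa [h] using hω'

end
end
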